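/- Let p be an odd prime, G a powerful p-group, N ≤ G^p with N of exponent p^2. Then every element of G^{p^2} ∩ N is central in N. -/

import Mathlib

/-- For a subgroup `H` of `G`, the subgroup generated by `n`-th powers of elements of `H`. -/
def sgPow {G : Type*} [Group G] (H : Subgroup G) (n : ℕ) : Subgroup G :=
  Subgroup.closure {x | ∃ h ∈ H, h ^ n = x}

open scoped commutatorElement

section ClassTwoPowers

variable {G : Type*} [Group G]

/-- If `⁅c, x⁆` commutes with `x` and `c`, moving `x` past `c ^ n` produces `⁅c, x⁆ ^ n`. -/
lemma pow_mul_eq_commutator_pow_mul {x c : G} (hc : Commute ⁅c, x⁆ c) (n : ℕ) :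
    c ^ n * x = ⁅c, x⁆ ^ n * x * c ^ n := by
  have h1 : c * x * c⁻¹ = ⁅c, x⁆ * x := by simp [commutatorElement_def]
  induction n with
  | zero => simp
  | succ n ih =>
    have h2 : c * x = ⁅c, x⁆ * x * c := by rw [← h1]; group
    calc c ^ (n + 1) * x = c * (c ^ n * x) := by rw [pow_succ', mul_assoc]
      _ = c * ⁅c, x⁆ ^ n * x * c ^ n := by rw [ih]; simp only [mul_assoc]
      _ = ⁅c, x⁆ ^ n * (c * x) * c ^ n := by rw [← (hc.pow_left n).eq]; simp only [mul_assoc]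
      _ = ⁅c, x⁆ ^ (n + 1) * x * c ^ (n + 1) := by
        rw [h2, pow_succ, pow_succ']; simp only [mul_assoc]

lemma commutator_pow_eq_one_of_pow_eq_one {x c : G} (hc : Commute ⁅c, x⁆ c) {n : ℕ}
    (hn : c ^ n = 1) : ⁅c, x⁆ ^ n = 1 := by
  have h := pow_mul_eq_commutator_pow_mul hc n
  rw [hn] at h
  simpa using h.symm

lemma mul_pow_of_commute_commutator {x c : G} (hx : Commute ⁅c, x⁆ x) (hc : Commute ⁅c, x⁆ c)
    (n : ℕ) : (x * c) ^ n = ⁅c, x⁆ ^ (n.choose 2) * (x ^ n * c ^ n) := by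
  induction n with
  | zero => simp
  | succ n ih =>
    have h3 : ⁅c, x⁆ ^ n * x ^ n = x ^ n * ⁅c, x⁆ ^ n := (hx.pow_pow n n).eq
    calc (x * c) ^ (n + 1) = ⁅c, x⁆ ^ (n.choose 2) * (x ^ n * c ^ n) * (x * c) := by
          rw [pow_succ, ih]
      _ = ⁅c, x⁆ ^ (n.choose 2) * x ^ n * (c ^ n * x) * c := by simp only [mul_assoc]
      _ = ⁅c, x⁆ ^ (n.choose 2) * (x ^ n * ⁅c, x⁆ ^ n) * x * c ^ n * c := by
        rw [pow_mul_eq_commutator_pow_mul hc]; simp only [mul_assoc]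
      _ = ⁅c, x⁆ ^ ((n + 1).choose 2) * (x ^ (n + 1) * c ^ (n + 1)) := by
        rw [← h3, Nat.choose_succ_succ' n 1, Nat.choose_one_right, add_comm n, pow_add, pow_succ x,
          pow_succ c]
        simp only [mul_assoc]

lemma mul_pow_of_odd {x c : G} {p : ℕ} (hp : Odd p) (hx : Commute ⁅c, x⁆ x)
    (hc : Commute ⁅c, x⁆ c) (hz : ⁅c, x⁆ ^ p = 1) : (x * c) ^ p = x ^ p * c ^ p := by
  obtain ⟨k, rfl⟩ := hp
  have h : (2 * k + 1).choose 2 = (2 * k + 1) * k := by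
    rw [Nat.choose_two_right, Nat.add_sub_cancel, mul_left_comm, Nat.mul_div_cancel_left _ two_pos]
  rw [mul_pow_of_commute_commutator hx hc, h, pow_mul, hz, one_pow, one_mul]

lemma mul_pow_eq_of_pow_eq_one {x c : G} {p : ℕ} (hp : Odd p) (hx : Commute ⁅c, x⁆ x)
    (hc : Commute ⁅c, x⁆ c) (h : c ^ p = 1) : (x * c) ^ p = x ^ p := by
  rw [mul_pow_of_odd hp hx hc (commutator_pow_eq_one_of_pow_eq_one hc h), h, mul_one]

/-- The class-two power formula modulo a normal subgroup. -/
lemma mul_pow_mod_of_odd {K : Subgroup G} [K.Normal] {x c : G} {p : ℕ} (hp : Odd p)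
    (hx : ⁅⁅c, x⁆, x⁆ ∈ K) (hc : ⁅⁅c, x⁆, c⁆ ∈ K) (hz : ⁅c, x⁆ ^ p ∈ K) :
    (((x * c) ^ p : G) : G ⧸ K) = (x ^ p * c ^ p : G) := by
  rw [← QuotientGroup.eq_one_iff] at hx hc hz
  exact mul_pow_of_odd (x := (x : G ⧸ K)) (c := (c : G ⧸ K)) hp (commutatorElement_eq_one_iff_commute.1 hx)
    (commutatorElement_eq_one_iff_commute.1 hc) hz

lemma mul_pow_mod_of_pow_mem {K : Subgroup G} [K.Normal] {x c : G} {p : ℕ} (hp : Odd p)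
    (hx : ⁅⁅c, x⁆, x⁆ ∈ K) (hc : ⁅⁅c, x⁆, c⁆ ∈ K) (hz : c ^ p ∈ K) :
    (((x * c) ^ p : G) : G ⧸ K) = (x ^ p : G) := by
  rw [← QuotientGroup.eq_one_iff] at hx hc hz
  exact mul_pow_eq_of_pow_eq_one (x := (x : G ⧸ K)) (c := (c : G ⧸ K)) hp (commutatorElement_eq_one_iff_commute.1 hx)
    (commutatorElement_eq_one_iff_commute.1 hc) hz

lemma conj_eq_mul_commutator (x g : G) : g * x * g⁻¹ = x * ⁅x⁻¹, g⁆ := by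
  simp only [commutatorElement_def]; group

/-- If `c = ⁅v⁻¹, a⁆` has trivial `p`-th power and `⁅c, v⁆` commutes with `v` and `c`, then `a`
commutes with `v ^ p`. -/
lemma commute_pow_of_commutator {p : ℕ} (hodd : Odd p) {v a : G}
    (hc : ⁅v⁻¹, a⁆ ^ p = 1) (h1 : Commute ⁅⁅v⁻¹, a⁆, v⁆ v)
    (h2 : Commute ⁅⁅v⁻¹, a⁆, v⁆ ⁅v⁻¹, a⁆) : Commute (v ^ p) a := by
  have h := mul_pow_eq_of_pow_eq_one hodd h1 h2 hc
  rw [← conj_eq_mul_commutator, conj_pow, mul_inv_eq_iff_eq_mul] at h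
  exact h.symm

end ClassTwoPowers

section PowerSubgroups

variable {G : Type*} [Group G]

lemma pow_mem_sgPow {H : Subgroup G} {n : ℕ} {x : G} (hx : x ∈ H) : x ^ n ∈ sgPow H n :=
  Subgroup.subset_closure ⟨x, hx, rfl⟩

lemma sgPow_le {H K : Subgroup G} {n : ℕ} : sgPow H n ≤ K ↔ ∀ x ∈ H, x ^ n ∈ K := by
  rw [sgPow, Subgroup.closure_le]
  exact ⟨fun h x hx => h ⟨x, hx, rfl⟩, by rintro h _ ⟨x, hx, rfl⟩; exact h x hx⟩

lemma sgPow_le_self (H : Subgroup G) (n : ℕ) : sgPow H n ≤ H :=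
  sgPow_le.2 fun _ hx => pow_mem hx n

instance sgPow_normal (H : Subgroup G) [H.Normal] (n : ℕ) : (sgPow H n).Normal := by
  refine ⟨fun x hx g => ?_⟩
  have h : sgPow H n ≤ (sgPow H n).comap (MulAut.conj g).toMonoidHom := sgPow_le.2 fun y hy => by
    rw [Subgroup.mem_comap, map_pow]
    exact pow_mem_sgPow (Subgroup.Normal.conj_mem inferInstance y hy g)
  exact h hx

lemma map_sgPow {K : Type*} [Group K] (f : G →* K) (H : Subgroup G) (n : ℕ) :
    (sgPow H n).map f ≤ sgPow (H.map f) n := by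
  rw [Subgroup.map_le_iff_le_comap, sgPow_le]
  intro x hx
  rw [Subgroup.mem_comap, map_pow]
  exact pow_mem_sgPow (Subgroup.mem_map_of_mem f hx)

variable [Finite G] {p : ℕ} [Fact p.Prime]

/-- Maximal subgroups of a finite `p`-group contain all `p`-th powers. -/
lemma pow_mem_of_isCoatom (hG : IsPGroup p G) {M : Subgroup G} (hM : IsCoatom M) (g : G) :
    g ^ p ∈ M := by
  have := hG.isNilpotent
  have hn : M.Normal := Subgroup.NormalizerCondition.normal_of_coatom M Group.normalizerCondition_of_isNilpotent hM
  by_contra h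
  have htop : Subgroup.closure {g ^ p} ⊔ M = ⊤ := by
    refine hM.2 _ (lt_of_le_of_ne le_sup_right fun he => h ?_)
    rw [he]
    exact Subgroup.mem_sup_left (Subgroup.mem_closure_singleton_self _)
  obtain ⟨y, hy, z, hz, hyz⟩ := Subgroup.mem_sup_of_normal_right.1 (htop ▸ Subgroup.mem_top g)
  obtain ⟨k, rfl⟩ := Subgroup.mem_closure_singleton.1 hy
  have h1 : ((g : G ⧸ M)) = (g : G ⧸ M) ^ ((p : ℤ) * k) := by
    conv_lhs => rw [← hyz]
    rw [QuotientGroup.mk_mul, (QuotientGroup.eq_one_iff z).2 hz]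
    simp [zpow_mul]
  have h2 : (g : G ⧸ M) ^ ((p : ℤ) * k - 1) = 1 := by
    rw [zpow_sub, ← h1]; simp
  apply h
  rw [← QuotientGroup.eq_one_iff, QuotientGroup.mk_pow]
  rw [← orderOf_dvd_iff_zpow_eq_one] at h2
  obtain ⟨m, hm⟩ := (IsPGroup.iff_orderOf.1 (hG.to_quotient M)) (g : G ⧸ M)
  rcases Nat.eq_zero_or_pos m with rfl | hpos
  · rw [pow_zero, orderOf_eq_one_iff] at hm; simp [hm]
  · exfalso
    have h3 : (p : ℤ) ∣ (p : ℤ) * k - 1 :=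
      (Int.natCast_dvd_natCast.2 (hm ▸ dvd_pow_self p hpos.ne')).trans h2
    have h4 : (p : ℤ) ∣ 1 := by
      have := dvd_sub (dvd_mul_right (p : ℤ) k) h3
      simpa using this
    exact (Fact.out : p.Prime).one_lt.ne' (by exact_mod_cast Int.eq_one_of_dvd_one (by positivity) h4)

lemma sgPow_lt_self (hG : IsPGroup p G) {H : Subgroup G} (hH : H ≠ ⊥) : sgPow H p < H := by
  refine lt_of_le_of_ne (sgPow_le_self H p) fun he => ?_
  have : Nontrivial H := (Subgroup.nontrivial_iff_ne_bot H).2 hH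
  obtain ⟨M, hM, -⟩ := (eq_top_or_exists_le_coatom (⊥ : Subgroup H)).resolve_left bot_ne_top
  have h : sgPow H p ≤ M.map H.subtype := sgPow_le.2 fun x hx =>
    ⟨⟨x, hx⟩ ^ p, pow_mem_of_isCoatom (hG.to_subgroup H) hM _, rfl⟩
  refine hM.1 (eq_top_iff.2 fun x _ => ?_)
  obtain ⟨y, hy, hyx⟩ := h (he.ge x.2)
  rwa [← show y = x from Subtype.ext hyx]

/-- A subgroup that generates a finite `p`-group together with the `p`-th powers is everything. -/
lemma closure_eq_top_of_sup_sgPow (hG : IsPGroup p G) {H : Subgroup G}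
    (h : H ⊔ sgPow ⊤ p = ⊤) : H = ⊤ := by
  refine (eq_top_or_exists_le_coatom H).resolve_right ?_
  rintro ⟨M, hM, hHM⟩
  refine hM.1 (eq_top_iff.2 (h ▸ sup_le hHM (sgPow_le.2 fun x _ => pow_mem_of_isCoatom hG hM x)))

end PowerSubgroups

section PowerSeries

open Subgroup

variable {G : Type*} [Group G]

/-- The series `G ≥ G ^ p ≥ (G ^ p) ^ p ≥ …` of iterated power subgroups. -/
def powSeries (G : Type*) [Group G] (p : ℕ) : ℕ → Subgroup G
  | 0 => ⊤
  | i + 1 => sgPow (powSeries G p i) p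

instance powSeries_normal (p i : ℕ) : (powSeries G p i).Normal := by
  induction i with
  | zero => exact inferInstanceAs (⊤ : Subgroup G).Normal
  | succ i ih => exact sgPow_normal (powSeries G p i) p

lemma powSeries_antitone (p : ℕ) : Antitone (powSeries G p) :=
  antitone_nat_of_succ_le fun i => sgPow_le_self (powSeries G p i) p

lemma pow_mem_powSeries {p i : ℕ} {x : G} (hx : x ∈ powSeries G p i) :
    x ^ p ∈ powSeries G p (i + 1) :=
  pow_mem_sgPow hx

lemma map_powSeries_le {K : Type*} [Group K] (f : G →* K) (p i : ℕ) :
    (powSeries G p i).map f ≤ powSeries K p i := by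
  induction i with
  | zero => exact le_top
  | succ i ih =>
    refine (map_sgPow f _ p).trans (sgPow_le.2 fun x hx => pow_mem_powSeries (ih hx))

/-- In a nilpotent group, a subgroup contained in `K ⊔ ⁅D, G⁆` is contained in `K`. -/
lemma le_of_le_sup_commutator_top [Group.IsNilpotent G] {D K : Subgroup G} [D.Normal] [K.Normal]
    (h : D ≤ K ⊔ ⁅D, (⊤ : Subgroup G)⁆) : D ≤ K := by
  have key : ∀ n, D ≤ K ⊔ (⊤ : Subgroup G).lowerCentralSeries n := by
    intro n
    induction n with
    | zero => simp
    | succ n ih =>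
      refine h.trans (sup_le le_sup_left ?_)
      refine commutator_le.2 fun x hx g hg => ?_
      obtain ⟨k, hk, l, hl, rfl⟩ := mem_sup_of_normal_left.1 (ih hx)
      have e : ⁅k * l, g⁆ = k * ⁅l, g⁆ * k⁻¹ * ⁅k, g⁆ := by
        simp only [commutatorElement_def]; group
      rw [e]
      refine mul_mem (Normal.conj_mem inferInstance _ ?_ k) ?_
      · exact mem_sup_right (commutator_mem_commutator hl hg)
      · exact mem_sup_left (commutator_le_left K ⊤ (commutator_mem_commutator hk hg))
  obtain ⟨n, hn⟩ := Subgroup.nilpotent_iff_lowerCentralSeries.1 ‹Group.IsNilpotent G›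
  simpa [hn] using key n

/-- `p`-th powers of a powerfully embedded subgroup are powerfully embedded. -/
lemma commutator_sgPow_le [Group.IsNilpotent G] {p : ℕ} (hodd : Odd p) {N : Subgroup G} [N.Normal]
    (hN : ⁅N, (⊤ : Subgroup G)⁆ ≤ sgPow N p) :
    ⁅sgPow N p, (⊤ : Subgroup G)⁆ ≤ sgPow (sgPow N p) p := by
  set K := sgPow (sgPow N p) p
  set D := ⁅sgPow N p, (⊤ : Subgroup G)⁆
  set M := K ⊔ ⁅D, (⊤ : Subgroup G)⁆ with hM
  refine le_of_le_sup_commutator_top ?_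
  rw [← hM]
  have hcent : sgPow N p ≤ (center (G ⧸ M)).comap (QuotientGroup.mk' M) := by
    refine sgPow_le.2 fun x hx => ?_
    rw [mem_comap, mem_center_iff]
    intro q
    obtain ⟨g, rfl⟩ := QuotientGroup.mk'_surjective M q
    have hc : ⁅x⁻¹, g⁆ ∈ sgPow N p := hN (commutator_mem_commutator (inv_mem hx) (mem_top g))
    have hD : ⁅⁅x⁻¹, g⁆, x⁆ ∈ D := commutator_mem_commutator hc (mem_top x)
    have hE : ∀ y, ⁅⁅⁅x⁻¹, g⁆, x⁆, y⁆ ∈ M := fun y =>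
      mem_sup_right (commutator_mem_commutator hD (mem_top y))
    have h := mul_pow_mod_of_pow_mem hodd (hE x) (hE _) (mem_sup_left (pow_mem_sgPow hc) : _ ∈ M)
    rw [← conj_eq_mul_commutator, conj_pow] at h
    have h' : QuotientGroup.mk' M g * QuotientGroup.mk' M (x ^ p) * (QuotientGroup.mk' M g)⁻¹
      = QuotientGroup.mk' M (x ^ p) := h
    exact mul_inv_eq_iff_eq_mul.1 h'
  refine commutator_le.2 fun x hx g _ => ?_
  have hx' := mem_center_iff.1 (hcent hx) (QuotientGroup.mk' M g)
  rw [← QuotientGroup.eq_one_iff]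
  exact commutatorElement_eq_one_iff_commute.2 hx'.symm

lemma commutator_powSeries_le [Group.IsNilpotent G] {p : ℕ} (hodd : Odd p)
    (hpow : ⁅(⊤ : Subgroup G), (⊤ : Subgroup G)⁆ ≤ sgPow ⊤ p) (i : ℕ) :
    ⁅powSeries G p i, (⊤ : Subgroup G)⁆ ≤ powSeries G p (i + 1) := by
  induction i with
  | zero => exact hpow
  | succ i ih => exact commutator_sgPow_le hodd ih

variable [Finite G] {p : ℕ} [Fact p.Prime]

lemma exists_powSeries_eq_bot (hG : IsPGroup p G) : ∃ n, powSeries G p n = ⊥ := by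
  by_contra! h
  exact not_strictAnti_of_wellFoundedLT (powSeries G p)
    (strictAnti_nat_of_succ_lt fun i => sgPow_lt_self hG (h i))

lemma commutator_mem_powSeries (hodd : Odd p) (hG : IsPGroup p G)
    (hpow : ⁅(⊤ : Subgroup G), (⊤ : Subgroup G)⁆ ≤ sgPow ⊤ p) {i : ℕ} {x : G} (hx : x ∈ powSeries G p i) (y : G) :
    ⁅x, y⁆ ∈ powSeries G p (i + 1) :=
  have := hG.isNilpotent
  commutator_powSeries_le hodd hpow i (commutator_mem_commutator hx (mem_top y))

lemma mul_pow_mod_powSeries (hodd : Odd p) (hG : IsPGroup p G)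
    (hpow : ⁅(⊤ : Subgroup G), (⊤ : Subgroup G)⁆ ≤ sgPow ⊤ p) {m : ℕ} (x : G) {w : G} (hw : w ∈ powSeries G p m) :
    (((x * w) ^ p : G) : G ⧸ powSeries G p (m + 2)) = (x ^ p * w ^ p : G) := by
  have h := commutator_mem_powSeries hodd hG hpow hw x
  exact mul_pow_mod_of_odd hodd (commutator_mem_powSeries hodd hG hpow h x)
    (commutator_mem_powSeries hodd hG hpow h w) (pow_mem_powSeries h)

lemma exists_pow_mod_powSeries (hodd : Odd p) (hG : IsPGroup p G)
    (hpow : ⁅(⊤ : Subgroup G), (⊤ : Subgroup G)⁆ ≤ sgPow ⊤ p) {m : ℕ} {g : G} (hg : g ∈ powSeries G p (m + 1)) :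
    ∃ w ∈ powSeries G p m, (g : G ⧸ powSeries G p (m + 2)) = (w ^ p : G) := by
  change g ∈ Subgroup.closure _ at hg
  induction hg using Subgroup.closure_induction with
  | mem x hx =>
    obtain ⟨w, hw, rfl⟩ := hx
    exact ⟨w, hw, rfl⟩
  | one => exact ⟨1, one_mem _, by simp⟩
  | mul x y _ _ ihx ihy =>
    obtain ⟨v, hv, ev⟩ := ihx
    obtain ⟨w, hw, ew⟩ := ihy
    exact ⟨v * w, mul_mem hv hw, by
      rw [mul_pow_mod_powSeries hodd hG hpow v hw, QuotientGroup.mk_mul, ev, ew]; rfl⟩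
  | inv x _ ih =>
    obtain ⟨w, hw, ew⟩ := ih
    exact ⟨w⁻¹, inv_mem hw, by rw [QuotientGroup.mk_inv, ew, inv_pow]; rfl⟩

/-- In a powerful `p`-group, every element of the next power subgroup is a `p`-th power. -/
lemma exists_pow_eq_of_mem_powSeries (hodd : Odd p) (hG : IsPGroup p G)
    (hpow : ⁅(⊤ : Subgroup G), (⊤ : Subgroup G)⁆ ≤ sgPow ⊤ p) {m : ℕ} {g : G} (hg : g ∈ powSeries G p (m + 1)) :
    ∃ w ∈ powSeries G p m, w ^ p = g := by
  have key : ∀ t, ∃ w ∈ powSeries G p m, (w ^ p)⁻¹ * g ∈ powSeries G p (m + t + 1) := by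
    intro t
    induction t with
    | zero => exact ⟨1, one_mem _, by simpa using hg⟩
    | succ t ih =>
      obtain ⟨x, hx, hxg⟩ := ih
      obtain ⟨w, hw, e⟩ := exists_pow_mod_powSeries hodd hG hpow hxg
      refine ⟨x * w, mul_mem hx (powSeries_antitone p (Nat.le_add_right m t) hw), ?_⟩
      rw [show m + (t + 1) + 1 = m + t + 2 by ring, ← QuotientGroup.eq,
        mul_pow_mod_powSeries hodd hG hpow x hw, QuotientGroup.mk_mul, ← e, ← QuotientGroup.mk_mul,
        mul_inv_cancel_left]
  obtain ⟨n, hn⟩ := exists_powSeries_eq_bot hG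
  obtain ⟨w, hw, h⟩ := key n
  have h' := powSeries_antitone p (show n ≤ m + n + 1 by omega) h
  rw [hn, mem_bot] at h'
  exact ⟨w, hw, inv_mul_eq_one.1 h'⟩

end PowerSeries

section Omega

open Subgroup

/-- The `p`-torsion elements of a normal subgroup `H`, when closed under products, form a normal
subgroup. -/
lemma exists_normal_mem_iff_pow_eq_one {G : Type*} [Group G] (H : Subgroup G) [H.Normal] (p : ℕ)
    (hH : ∀ x ∈ H, ∀ y ∈ H, x ^ p = 1 → y ^ p = 1 → (x * y) ^ p = 1) :
    ∃ W : Subgroup G, W.Normal ∧ ∀ x, x ∈ W ↔ x ∈ H ∧ x ^ p = 1 :=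
  ⟨{ carrier := {x | x ∈ H ∧ x ^ p = 1}
     mul_mem' := fun hx hy => ⟨mul_mem hx.1 hy.1, hH _ hx.1 _ hy.1 hx.2 hy.2⟩
     one_mem' := ⟨one_mem H, one_pow p⟩
     inv_mem' := fun hx => ⟨inv_mem hx.1, by rw [inv_pow, hx.2, inv_one]⟩ },
   ⟨fun x hx g => ⟨Normal.conj_mem inferInstance x hx.1 g, by
     rw [conj_pow, hx.2, mul_one, mul_inv_cancel]⟩⟩, fun _ => Iff.rfl⟩

lemma commutator_top_quotient_le {G : Type*} [Group G] {p : ℕ} (W : Subgroup G) [W.Normal]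
    (hpow : ⁅(⊤ : Subgroup G), (⊤ : Subgroup G)⁆ ≤ sgPow ⊤ p) :
    ⁅(⊤ : Subgroup (G ⧸ W)), (⊤ : Subgroup (G ⧸ W))⁆ ≤ sgPow ⊤ p := by
  have h := (map_mono (f := QuotientGroup.mk' W) hpow).trans (map_sgPow _ _ p)
  rwa [map_commutator, map_top_of_surjective _ (QuotientGroup.mk'_surjective W)] at h

variable {p : ℕ} [Fact p.Prime]

/-- In a powerful `p`-group `G`, the subgroup `⟨a, G ^ p⟩` is powerful. -/
lemma commutator_top_closure_sup_le {G : Type*} [Group G] [Finite G] (hodd : Odd p)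
    (hG : IsPGroup p G) (hpow : ⁅(⊤ : Subgroup G), (⊤ : Subgroup G)⁆ ≤ sgPow ⊤ p) (a : G)
    {H : Subgroup G} (hH : H = zpowers a ⊔ sgPow ⊤ p) :
    ⁅(⊤ : Subgroup H), (⊤ : Subgroup H)⁆ ≤ sgPow ⊤ p := by
  have := hG.isNilpotent
  have h2 : powSeries G p 2 ≤ (sgPow (⊤ : Subgroup H) p).map H.subtype :=
    sgPow_le.2 fun x hx => by
      have hxH : x ∈ H := hH ▸ mem_sup_right hx
      exact ⟨⟨x, hxH⟩ ^ p, pow_mem_sgPow (mem_top _), rfl⟩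
  refine commutator_le.2 fun x _ y _ => ?_
  have hxy : ⁅(x : G), (y : G)⁆ ∈ powSeries G p 2 := by
    obtain ⟨_, ⟨i, rfl⟩, s, hs, hx⟩ := mem_sup_of_normal_right.1 (hH.le x.2)
    obtain ⟨_, ⟨j, rfl⟩, t, ht, hy⟩ := mem_sup_of_normal_right.1 (hH.le y.2)
    have hcent : ∀ r ∈ sgPow (⊤ : Subgroup G) p, ∀ g : G,
        Commute (r : G ⧸ powSeries G p 2) (g : G ⧸ powSeries G p 2) := fun r hr g =>
      commutatorElement_eq_one_iff_commute.1 ((QuotientGroup.eq_one_iff _).2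
        (commutator_mem_powSeries (i := 1) hodd hG hpow hr g))
    rw [← hx, ← hy, ← QuotientGroup.eq_one_iff]
    change ⁅(a ^ i * s : G ⧸ powSeries G p 2), (a ^ j * t : G ⧸ powSeries G p 2)⁆ = 1
    refine commutatorElement_eq_one_iff_commute.2
      (Commute.mul_left ?_ (by simpa using hcent s hs (a ^ j * t)))
    refine Commute.mul_right ?_ (by simpa using (hcent t ht (a ^ i)).symm)
    exact (Commute.refl (a : G ⧸ powSeries G p 2)).zpow_zpow i j
  obtain ⟨w, hw, e⟩ := h2 hxy
  have : w = ⁅x, y⁆ := Subtype.ext e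
  exact this ▸ hw

/-- Products of elements with trivial `p`-th power have trivial `p`-th power. -/
def PowEqOneMulClosed (G : Type*) [Group G] (p : ℕ) : Prop :=
  ∀ x y : G, x ^ p = 1 → y ^ p = 1 → (x * y) ^ p = 1

/-- The elements of `powSeries G p i` with trivial `p`-th power commute with all elements with
trivial `p ^ i`-th power. -/
def TorsionCommutes (G : Type*) [Group G] (p i : ℕ) : Prop :=
  ∀ u ∈ powSeries G p i, u ^ p = 1 → ∀ a : G, a ^ p ^ i = 1 → Commute u a

/-- A normal subgroup of exponent dividing `p` containing all powers of `a` and all elements of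
`G ^ p` with trivial `p`-th power. -/
structure IsTorsionHull {G : Type*} [Group G] (p : ℕ) (a : G) (W : Subgroup G) : Prop where
  normal : W.Normal
  pow_eq_one : ∀ x ∈ W, x ^ p = 1
  mem_of_mem_powSeries : ∀ x ∈ powSeries G p 1, x ^ p = 1 → x ∈ W
  pow_mem : ∀ j, (a ^ j) ^ p = 1 → a ^ j ∈ W

lemma commute_or_exists_isTorsionHull {G : Type*} [Group G] [Finite G] (hodd : Odd p)
    (hG : IsPGroup p G) (hpow : ⁅(⊤ : Subgroup G), (⊤ : Subgroup G)⁆ ≤ sgPow ⊤ p)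
    (ih : ∀ H : Subgroup G, H ≠ ⊤ → ⁅(⊤ : Subgroup H), (⊤ : Subgroup H)⁆ ≤ sgPow ⊤ p →
      PowEqOneMulClosed H p) (a : G) :
    (∀ x y : G, Commute x y) ∨ ∃ W, IsTorsionHull p a W := by
  set H := zpowers a ⊔ sgPow (⊤ : Subgroup G) p with hH
  by_cases htop : H = ⊤
  · left
    intro x y
    have h := closure_eq_top_of_sup_sgPow hG htop
    obtain ⟨i, rfl⟩ : x ∈ zpowers a := h ▸ mem_top x
    obtain ⟨j, rfl⟩ : y ∈ zpowers a := h ▸ mem_top y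
    exact (Commute.refl a).zpow_zpow i j
  · right
    have hn : H.Normal := by
      refine ⟨fun x hx g => ?_⟩
      rw [conj_eq_mul_commutator]
      exact mul_mem hx (mem_sup_right (hpow (commutator_mem_commutator (mem_top _) (mem_top _))))
    have hcl := ih H htop (commutator_top_closure_sup_le hodd hG hpow a hH)
    obtain ⟨W, hW, hmem⟩ := exists_normal_mem_iff_pow_eq_one H p fun x hx y hy hx1 hy1 =>
      congrArg Subtype.val (hcl ⟨x, hx⟩ ⟨y, hy⟩ (Subtype.ext hx1) (Subtype.ext hy1))
    exact ⟨W, hW, fun x hx => ((hmem x).1 hx).2,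
      fun x hx hx1 => (hmem x).2 ⟨mem_sup_right hx, hx1⟩,
      fun j hj => (hmem _).2 ⟨mem_sup_left (pow_mem (mem_zpowers a) j), hj⟩⟩

lemma pow_pow_eq_one_of_le {G : Type*} [Group G] {x : G} {q i j : ℕ} (hx : x ^ q ^ i = 1)
    (hij : i ≤ j) : x ^ q ^ j = 1 := by
  obtain ⟨k, rfl⟩ := Nat.exists_eq_add_of_le hij
  rw [pow_add, pow_mul, hx, one_pow]

lemma commute_of_isTorsionHull {G : Type*} [Group G] [Finite G] (hodd : Odd p)
    (hG : IsPGroup p G) (hpow : ⁅(⊤ : Subgroup G), (⊤ : Subgroup G)⁆ ≤ sgPow ⊤ p)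
    {i : ℕ} (ihG : TorsionCommutes G p (i + 2))
    (ihQ : ∀ (W : Subgroup G) [W.Normal], W ≠ ⊥ → 1 ≤ i → TorsionCommutes (G ⧸ W) p i)
    {a u : G} {W : Subgroup G} (hW : IsTorsionHull p a W) (hu : u ∈ powSeries G p (i + 1))
    (hup : u ^ p = 1) (ha : a ^ p ^ (i + 1) = 1) : Commute u a := by
  have := hW.normal
  obtain ⟨v, hv, rfl⟩ := exists_pow_eq_of_mem_powSeries hodd hG hpow hu
  by_cases hv1 : v ^ p = 1
  · rw [hv1]; exact Commute.one_left a
  have hvW : v ^ p ∈ W := hW.mem_of_mem_powSeries _ (powSeries_antitone p (by omega) hu) hup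
  have hcW : ⁅v⁻¹, a⁆ ∈ W := by
    rcases Nat.eq_zero_or_pos i with rfl | hi
    · have haW : a ∈ W := by simpa using hW.pow_mem 1 (by simpa using ha)
      exact mul_mem (hW.normal.conj_mem' a haW v |> fun h => by simpa using h) (inv_mem haW)
    · have hWbot : W ≠ ⊥ := fun h => hv1 (mem_bot.1 (h ▸ hvW))
      have haW := hW.pow_mem (p ^ i) (by rw [← pow_mul, ← pow_succ, ha])
      have hcomm := ihQ W hWbot hi v (map_powSeries_le (QuotientGroup.mk' W) p i ⟨v, hv, rfl⟩)
        ((QuotientGroup.eq_one_iff _).2 hvW) a ((QuotientGroup.eq_one_iff _).2 haW)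
      exact (QuotientGroup.eq_one_iff _).1
        (commutatorElement_eq_one_iff_commute.2 hcomm.inv_left)
  have hcF : ⁅v⁻¹, a⁆ ∈ powSeries G p (i + 1) :=
    commutator_mem_powSeries hodd hG hpow (inv_mem hv) a
  have hz : ⁅⁅v⁻¹, a⁆, v⁆ ^ p = 1 :=
    hW.pow_eq_one _ (commutator_le_left W ⊤ (commutator_mem_commutator hcW (mem_top v)))
  have hzF := commutator_mem_powSeries hodd hG hpow hcF v
  have hc := hW.pow_eq_one _ hcW
  refine commute_pow_of_commutator hodd hc (ihG _ hzF hz _ ?_) (ihG _ hzF hz _ ?_)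
  · exact pow_pow_eq_one_of_le (i := 2) (by rw [pow_two, pow_mul, hup]) (by omega)
  · exact pow_pow_eq_one_of_le (i := 1) (by rw [pow_one, hc]) (by omega)

universe u

/-- Main structural result on elements of order `p` in powerful `p`-groups, `p` odd. -/
theorem powEqOneMulClosed_and_torsionCommutes (hodd : Odd p) (n : ℕ) :
    ∀ (G : Type u) [Group G] [Finite G], Nat.card G = n → IsPGroup p G →
      ⁅(⊤ : Subgroup G), (⊤ : Subgroup G)⁆ ≤ sgPow ⊤ p →
      PowEqOneMulClosed G p ∧ ∀ i, 1 ≤ i → TorsionCommutes G p i := by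
  induction n using Nat.strong_induction_on with
  | _ n ih =>
    intro G _ _ hcard hG hpow
    have ihH : ∀ H : Subgroup G, H ≠ ⊤ → ⁅(⊤ : Subgroup H), (⊤ : Subgroup H)⁆ ≤ sgPow ⊤ p →
        PowEqOneMulClosed H p := fun H hH hHp =>
      (ih _ (hcard ▸ (card_le_card_group H).lt_of_ne fun h => hH (eq_top_of_card_eq H h)) H rfl
        (hG.to_subgroup H) hHp).1
    have ihQ : ∀ i (W : Subgroup G) [W.Normal], W ≠ ⊥ → 1 ≤ i → TorsionCommutes (G ⧸ W) p i := by
      intro i W _ hW hi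
      refine (ih _ ?_ (G ⧸ W) rfl (hG.to_quotient W) (commutator_top_quotient_le W hpow)).2 i hi
      have h1 := card_eq_card_quotient_mul_card_subgroup W
      have h2 : 1 < Nat.card W := (one_lt_card_iff_ne_bot W).2 hW
      have h3 : 0 < Nat.card (G ⧸ W) := Nat.card_pos
      rw [← hcard, h1]
      exact lt_mul_of_one_lt_right h3 h2
    have hhull := commute_or_exists_isTorsionHull hodd hG hpow ihH
    have hcommutes : ∀ i, 1 ≤ i → TorsionCommutes G p i := by
      obtain ⟨m, hm⟩ := exists_powSeries_eq_bot hG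
      have key : ∀ k i, m ≤ i + k → 1 ≤ i → TorsionCommutes G p i := by
        intro k
        induction k with
        | zero =>
          intro i hi _ u hu _ a _
          have hu' := powSeries_antitone p (show m ≤ i by omega) hu
          rw [hm, mem_bot] at hu'
          rw [hu']; exact Commute.one_left a
        | succ k ihk =>
          intro i hi hi1 u hu hup a ha
          obtain ⟨i, rfl⟩ := Nat.exists_eq_add_of_le' hi1
          rcases hhull a with h | ⟨W, hW⟩
          · exact h u a
          · exact commute_of_isTorsionHull hodd hG hpow (ihk (i + 2) (by omega) (by omega))
              (ihQ i) hW hu hup ha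
      exact fun i => key m i (by omega)
    refine ⟨fun x y hx hy => ?_, hcommutes⟩
    rcases hhull y with h | ⟨W, hW⟩
    · rw [(h x y).mul_pow, hx, hy, one_mul]
    · have := hW.normal
      have hyW : y ∈ W := by simpa using hW.pow_mem 1 (by simpa using hy)
      have hz := hW.pow_eq_one _
        (commutator_le_left W ⊤ (commutator_mem_commutator hyW (mem_top x)))
      have hzF : ⁅y, x⁆ ∈ powSeries G p 1 :=
        hpow (commutator_mem_commutator (mem_top y) (mem_top x))
      have hcomm := fun a ha => hcommutes 1 le_rfl _ hzF hz a (by rwa [pow_one])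
      rw [mul_pow_eq_of_pow_eq_one hodd (hcomm x hx) (hcomm y hy) hy, hx]

end Omega

/-- if G is a powerful p-group (p odd), N ≤ G^p and N has exponent p²,
then every element of G^{p²} ∩ N is central in N. -/
theorem stmt3 {G : Type*} [Group G] [Finite G] (p : ℕ) (hp : p.Prime) (hodd : Odd p)
    (hpG : IsPGroup p G)
    (hpowerful : ⁅(⊤ : Subgroup G), (⊤ : Subgroup G)⁆ ≤ sgPow ⊤ p)
    (N : Subgroup G) (hNle : N ≤ sgPow ⊤ p)
    (hexp : Monoid.exponent N = p ^ 2)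
    (x : G) (hx : x ∈ sgPow (⊤ : Subgroup G) (p ^ 2) ⊓ N) :
    ∀ y ∈ N, Commute x y := by
  intro y hy
  have : Fact p.Prime := ⟨hp⟩
  have hpow : ∀ z ∈ N, z ^ p ^ 2 = 1 := fun z hz =>
    congrArg Subtype.val (hexp ▸ Monoid.pow_exponent_eq_one (⟨z, hz⟩ : N))
  obtain ⟨hmul, hcommutes⟩ :=
    powEqOneMulClosed_and_torsionCommutes hodd _ G rfl hpG hpowerful
  have hxF : x ∈ powSeries G p 2 := by
    refine (sgPow_le.2 fun g _ => ?_ : sgPow (⊤ : Subgroup G) (p ^ 2) ≤ powSeries G p 2) hx.1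
    rw [pow_two, pow_mul]
    exact pow_mem_powSeries (pow_mem_powSeries (i := 0) (Subgroup.mem_top g))
  obtain ⟨h, -, rfl⟩ := exists_pow_eq_of_mem_powSeries (m := 0) hodd hpG hpowerful (hNle hy)
  obtain ⟨W, hW, hmem⟩ := exists_normal_mem_iff_pow_eq_one (⊤ : Subgroup G) p
    fun x _ y _ => hmul x y
  have hx2 := hpow x hx.2
  have hh2 := hpow _ hy
  rw [pow_two, pow_mul] at hx2
  rw [← pow_mul, ← pow_succ'] at hh2
  have hquot := (powEqOneMulClosed_and_torsionCommutes hodd _ (G ⧸ W) rfl (hpG.to_quotient W)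
    (commutator_top_quotient_le W hpowerful)).2 2 one_le_two x
    (map_powSeries_le (QuotientGroup.mk' W) p 2 ⟨x, hxF, rfl⟩)
    ((QuotientGroup.eq_one_iff _).2 ((hmem _).2 ⟨Subgroup.mem_top _, hx2⟩)) h
    ((QuotientGroup.eq_one_iff _).2 ((hmem _).2 ⟨Subgroup.mem_top _, by
      rw [← pow_mul, ← pow_succ, hh2]⟩))
  have hc : ⁅h⁻¹, x⁆ ^ p = 1 := ((hmem _).1 ((QuotientGroup.eq_one_iff _).1
    (commutatorElement_eq_one_iff_commute.2 hquot.symm.inv_left))).2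
  have hcF : ⁅h⁻¹, x⁆ ∈ powSeries G p 3 := by
    rw [← commutatorElement_inv]
    exact inv_mem (commutator_mem_powSeries hodd hpG hpowerful hxF _)
  have hz : ⁅⁅h⁻¹, x⁆, h⁆ = 1 :=
    commutatorElement_eq_one_iff_commute.2 (hcommutes 3 (by omega) _ hcF hc h hh2)
  refine (commute_pow_of_commutator hodd hc ?_ ?_).symm <;> rw [hz] <;> exact Commute.one_left _
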